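/- Let d ≥ 1 and 1 < p < 1 + 2/d. Then the function λ ↦ J(λ) is strictly decreasing on (0,∞) — indeed J(λ) < J(λ') whenever 0 < λ' < λ — and it is continuous on [0,∞). -/

import Mathlib

open MeasureTheory Real Filter Topology

noncomputable section

/-- Euclidean space `ℝ^d`. -/
abbrev Ed (d : ℕ) : Type := EuclideanSpace ℝ (Fin d)

/-- An admissible `N`-tuple: each component is continuously differentiable,
square-integrable with square-integrable gradient, and the components are
orthonormal in `L²(ℝ^d)`. -/
structure Admissible (d N : ℕ) (u : Fin N → Ed d → ℂ) : Prop where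
  contDiff : ∀ n, ContDiff ℝ 1 (u n)
  sqInt : ∀ n, Integrable (fun x : Ed d => ‖u n x‖ ^ 2)
  gradSqInt : ∀ n, Integrable (fun x : Ed d => ‖fderiv ℝ (u n) x‖ ^ 2)
  orthonormal : ∀ j k, ∫ x : Ed d, u j x * (starRingEnd ℂ) (u k x)
      = if j = k then 1 else 0

/-- The density `ρ_u = ∑ₙ |uₙ|²` of an `N`-tuple. -/
def density (d N : ℕ) (u : Fin N → Ed d → ℂ) (x : Ed d) : ℝ :=
  ∑ n, ‖u n x‖ ^ 2

/-- The NLS energy of an `N`-tuple. -/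
def energy (d N : ℕ) (p : ℝ) (u : Fin N → Ed d → ℂ) : ℝ :=
  (∑ n, ∫ x : Ed d, ‖fderiv ℝ (u n) x‖ ^ 2)
    - (1 / p) * ∫ x : Ed d, density d N u x ^ p

/-- `J(N)`: the infimum of the energy over admissible `N`-tuples. -/
def J (d : ℕ) (p : ℝ) (N : ℕ) : ℝ :=
  sInf { e : ℝ | ∃ u : Fin N → Ed d → ℂ, Admissible d N u ∧ e = energy d N p u }

/-- The occupation weight: `λ - N + 1` on the last index, `1` otherwise. -/
def wt (N : ℕ) (lam : ℝ) (n : Fin N) : ℝ :=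
  if (n : ℕ) = N - 1 then lam - N + 1 else 1

/-- The weighted density `ρ_{u,λ}`. -/
def densityW (d N : ℕ) (lam : ℝ) (u : Fin N → Ed d → ℂ) (x : Ed d) : ℝ :=
  ∑ n, wt N lam n * ‖u n x‖ ^ 2

/-- The weighted kinetic energy `T_λ(u)`. -/
def kineticW (d N : ℕ) (lam : ℝ) (u : Fin N → Ed d → ℂ) : ℝ :=
  ∑ n, wt N lam n * ∫ x : Ed d, ‖fderiv ℝ (u n) x‖ ^ 2

/-- The weighted energy `E_λ(u)`. -/
def energyW (d N : ℕ) (p lam : ℝ) (u : Fin N → Ed d → ℂ) : ℝ :=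
  kineticW d N lam u - (1 / p) * ∫ x : Ed d, densityW d N lam u x ^ p

/-- `J(λ)` for real `λ`: the infimum of the weighted energy over admissible
`⌈λ⌉`-tuples. -/
def Jw (d : ℕ) (p : ℝ) (lam : ℝ) : ℝ :=
  sInf { e : ℝ | ∃ u : Fin ⌈lam⌉₊ → Ed d → ℂ,
    Admissible d ⌈lam⌉₊ u ∧ e = energyW d ⌈lam⌉₊ p lam u }

/-- The one-function NLS infimum `I(d,p,λ)`. -/
def Infimum1 (d : ℕ) (p lam : ℝ) : ℝ :=
  sInf { e : ℝ | ∃ u : Ed d → ℂ, ContDiff ℝ 1 u ∧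
    Integrable (fun x : Ed d => ‖u x‖ ^ 2) ∧
    Integrable (fun x : Ed d => ‖fderiv ℝ u x‖ ^ 2) ∧
    (∫ x : Ed d, ‖u x‖ ^ 2) = lam ∧
    e = (∫ x : Ed d, ‖fderiv ℝ u x‖ ^ 2)
        - (1 / p) * ∫ x : Ed d, ‖u x‖ ^ (2 * p) }

/-- The Laplacian of `f : ℝ^d → ℂ`, as the sum of the second partial
derivatives in the coordinate directions. -/
def lap (d : ℕ) (f : Ed d → ℂ) (x : Ed d) : ℂ :=
  ∑ i : Fin d,
    fderiv ℝ (fun y => fderiv ℝ f y (EuclideanSpace.single i (1 : ℝ))) x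
      (EuclideanSpace.single i (1 : ℝ))

/-- The `q`-spherical average `[f]_q(x)`, computed with respect to the surface
measure on the unit sphere. -/
def sphAvg (d : ℕ) (q : ℝ) (f : Ed d → ℝ) (x : Ed d) : ℝ :=
  (∫ ω : Metric.sphere (0 : Ed d) 1, |f (‖x‖ • (ω : Ed d))| ^ q
      ∂((volume : Measure (Ed d)).toSphere)) ^ (1 / q)

/-- The surface measure of the unit sphere `S^{d-1} ⊂ ℝ^d`. -/
def omegaSphere (d : ℕ) : ℝ :=
  (((volume : Measure (Ed d)).toSphere) Set.univ).toReal

/-- The Thomas–Fermi constant. -/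
def cTF (d : ℕ) : ℝ :=
  (4 * π ^ 2 * d / (d + 2)) * ((d : ℝ) / omegaSphere d) ^ (2 / (d : ℝ))


lemma sq_lintegral_le_lintegral_sq {α : Type*} [MeasurableSpace α] {μ : Measure α}
    [IsProbabilityMeasure μ] {f : α → ENNReal} (hf : AEMeasurable f μ) :
    (∫⁻ a, f a ∂μ) ^ 2 ≤ ∫⁻ a, f a ^ 2 ∂μ := by
  have h := ENNReal.lintegral_mul_le_Lp_mul_Lq μ Real.HolderConjugate.two_two hf
    (aemeasurable_const (b := (1 : ENNReal)))
  simp only [Pi.mul_apply, mul_one, ENNReal.one_rpow, lintegral_const, measure_univ,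
    ENNReal.rpow_two, one_pow] at h
  calc (∫⁻ a, f a ∂μ) ^ 2 ≤ ((∫⁻ a, f a ^ 2 ∂μ) ^ (1 / 2 : ℝ)) ^ 2 := by gcongr
    _ = ∫⁻ a, f a ^ 2 ∂μ := by
      rw [← ENNReal.rpow_two, ← ENNReal.rpow_mul]; norm_num

lemma enorm_sub_sq_le_lintegral_fderiv {d : ℕ} {u : Ed d → ℂ} (hu : ContDiff ℝ 1 u)
    (x h : Ed d) :
    ‖u (x + h) - u x‖ₑ ^ 2 ≤
      ∫⁻ s in Set.Ioc (0 : ℝ) 1, ‖h‖ₑ ^ 2 * ‖fderiv ℝ u (x + s • h)‖ₑ ^ 2 := by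
  have hc : Continuous (fun s : ℝ => fderiv ℝ u (x + s • h) h) :=
    ((hu.continuous_fderiv one_ne_zero).comp (by fun_prop)).clm_apply continuous_const
  have hd : ∀ s : ℝ, HasDerivAt (fun s : ℝ => u (x + s • h)) (fderiv ℝ u (x + s • h) h) s := by
    intro s
    have h1 : HasDerivAt (fun s : ℝ => x + s • h) h s := by
      simpa using ((hasDerivAt_id s).smul_const h).const_add x
    exact ((hu.differentiable one_ne_zero) _).hasFDerivAt.comp_hasDerivAt s h1
  have h2 := intervalIntegral.integral_eq_sub_of_hasDerivAt (a := 0) (b := 1)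
    (fun s _ => hd s) (hc.intervalIntegrable _ _)
  simp only [one_smul, zero_smul, add_zero] at h2
  rw [← h2, intervalIntegral.integral_of_le zero_le_one]
  have : IsProbabilityMeasure (volume.restrict (Set.Ioc (0 : ℝ) 1)) := ⟨by simp⟩
  calc _ ≤ (∫⁻ s in Set.Ioc (0 : ℝ) 1, ‖fderiv ℝ u (x + s • h) h‖ₑ) ^ 2 := by
        gcongr; exact enorm_integral_le_lintegral_enorm _
    _ ≤ ∫⁻ s in Set.Ioc (0 : ℝ) 1, ‖fderiv ℝ u (x + s • h) h‖ₑ ^ 2 :=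
        sq_lintegral_le_lintegral_sq hc.enorm.measurable.aemeasurable
    _ ≤ _ := by
        gcongr with s
        rw [← mul_pow, mul_comm]
        gcongr
        exact ContinuousLinearMap.le_opENorm _ _

lemma lintegral_enorm_translate_sub_sq_le {d : ℕ} {u : Ed d → ℂ} (hu : ContDiff ℝ 1 u)
    (h : Ed d) :
    ∫⁻ x, ‖u (x + h) - u x‖ₑ ^ 2 ≤ ‖h‖ₑ ^ 2 * ∫⁻ x, ‖fderiv ℝ u x‖ₑ ^ 2 := by
  have hc := hu.continuous_fderiv one_ne_zero
  calc _ ≤ ∫⁻ x, ∫⁻ s in Set.Ioc (0 : ℝ) 1, ‖h‖ₑ ^ 2 * ‖fderiv ℝ u (x + s • h)‖ₑ ^ 2 :=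
        lintegral_mono fun x => enorm_sub_sq_le_lintegral_fderiv hu x h
    _ = ∫⁻ s in Set.Ioc (0 : ℝ) 1, ∫⁻ x, ‖h‖ₑ ^ 2 * ‖fderiv ℝ u (x + s • h)‖ₑ ^ 2 := by
        refine lintegral_lintegral_swap (Measurable.aemeasurable ?_)
        exact ((hc.comp (f := fun q : Ed d × ℝ => q.1 + q.2 • h)
          (by fun_prop)).enorm.measurable.pow_const 2).const_mul _
    _ = ∫⁻ s in Set.Ioc (0 : ℝ) 1, ‖h‖ₑ ^ 2 * ∫⁻ x, ‖fderiv ℝ u x‖ₑ ^ 2 := by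
        refine lintegral_congr fun s => ?_
        have hm : Measurable (fun x => ‖fderiv ℝ u (x + s • h)‖ₑ ^ 2) :=
          (hc.comp (f := fun x => x + s • h) (by fun_prop)).enorm.measurable.pow_const 2
        rw [lintegral_const_mul _ hm,
          lintegral_add_right_eq_self (fun x => ‖fderiv ℝ u x‖ₑ ^ 2) (s • h)]
    _ = _ := by simp

/-- Weak-type bound: averaging over balls of volume at least `4 / t` controls the measure of
the set where `‖u‖² ≥ t` by the Dirichlet integral. -/
lemma meas_superlevel_le {d : ℕ} {u : Ed d → ℂ} (hu : ContDiff ℝ 1 u)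
    (h1 : ∫⁻ x, ‖u x‖ₑ ^ 2 ≤ 1) {t : ENNReal} (ht : t ≠ ⊤) {r : ℝ}
    (hr : 4 ≤ volume (Metric.ball (0 : Ed d) r) * t) :
    t * volume {x | t ≤ ‖u x‖ₑ ^ 2} ≤
      4 * (ENNReal.ofReal r ^ 2 * ∫⁻ x, ‖fderiv ℝ u x‖ₑ ^ 2) := by
  set V := volume (Metric.ball (0 : Ed d) r) with hV
  have hVt : V ≠ ⊤ := measure_ball_lt_top.ne
  have hV0 : V ≠ 0 := by rintro h; simp [h] at hr
  have huc := hu.continuous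
  set g : Ed d → ENNReal := fun x => ∫⁻ h in Metric.ball (0 : Ed d) r, ‖u (x + h) - u x‖ₑ ^ 2
    with hg
  have hmeas : Measurable (fun q : Ed d × Ed d => ‖u (q.1 + q.2) - u q.1‖ₑ ^ 2) :=
    (Continuous.enorm (by fun_prop)).measurable.pow_const 2
  have hgm : Measurable g := Measurable.lintegral_prod_right' hmeas
  have hpt : ∀ x, V * ‖u x‖ₑ ^ 2 ≤ 2 * g x + 2 := by
    intro x
    have e1 : ∀ h, ‖u x‖ₑ ^ 2 ≤ 2 * ‖u (x + h) - u x‖ₑ ^ 2 + 2 * ‖u (x + h)‖ₑ ^ 2 := by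
      intro h
      have a1 : ‖u x‖ ^ 2 ≤ 2 * ‖u (x + h) - u x‖ ^ 2 + 2 * ‖u (x + h)‖ ^ 2 := by
        have := norm_sub_norm_le (u x) (u (x + h))
        rw [norm_sub_rev] at this
        nlinarith [sq_nonneg (‖u (x + h) - u x‖ - ‖u (x + h)‖), norm_nonneg (u x),
          norm_nonneg (u (x + h) - u x), norm_nonneg (u (x + h))]
      have := ENNReal.ofReal_le_ofReal a1
      rw [ENNReal.ofReal_add (by positivity) (by positivity),
        ENNReal.ofReal_mul (by positivity), ENNReal.ofReal_mul (by positivity),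
        ENNReal.ofReal_pow (by positivity), ENNReal.ofReal_pow (by positivity),
        ENNReal.ofReal_pow (by positivity)] at this
      simpa [ofReal_norm] using this
    calc V * ‖u x‖ₑ ^ 2 = ∫⁻ h in Metric.ball (0 : Ed d) r, ‖u x‖ₑ ^ 2 := by
          simp [hV, mul_comm]
      _ ≤ ∫⁻ h in Metric.ball (0 : Ed d) r,
          (2 * ‖u (x + h) - u x‖ₑ ^ 2 + 2 * ‖u (x + h)‖ₑ ^ 2) := lintegral_mono fun h => e1 h
      _ = 2 * g x + 2 * ∫⁻ h in Metric.ball (0 : Ed d) r, ‖u (x + h)‖ₑ ^ 2 := by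
          rw [lintegral_add_left, lintegral_const_mul, lintegral_const_mul]
          · exact (Continuous.enorm (by fun_prop)).measurable.pow_const 2
          · exact (Continuous.enorm (by fun_prop)).measurable.pow_const 2
          · exact ((Continuous.enorm (by fun_prop)).measurable.pow_const 2).const_mul _
      _ ≤ 2 * g x + 2 * 1 := by
          gcongr
          refine (setLIntegral_le_lintegral _ _).trans ?_
          rw [lintegral_add_left_eq_self (fun h => ‖u h‖ₑ ^ 2) x]
          exact h1
      _ = _ := by rw [mul_one]
  have hsub : {x | t ≤ ‖u x‖ₑ ^ 2} ⊆ {x | V * t ≤ 4 * g x} := by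
    intro x hx
    have h2 : V * t ≤ 2 * g x + 2 := le_trans (by gcongr; exact hx) (hpt x)
    have hVtt : V * t ≠ ⊤ := ENNReal.mul_ne_top hVt ht
    simp only [Set.mem_ofPred_eq]
    by_cases hgx : g x = ⊤
    · simp [hgx]
    lift g x to NNReal using hgx with y hy
    lift V * t to NNReal using hVtt with z hz
    norm_cast at *
    have h3 : (z : ℝ) ≤ 2 * y + 2 := by exact_mod_cast h2
    have h4 : (4 : ℝ) ≤ z := by exact_mod_cast hr
    have : (z : ℝ) ≤ 4 * y := by linarith
    exact_mod_cast this
  have hcheb := mul_meas_ge_le_lintegral (μ := (volume : Measure (Ed d)))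
    (hgm.const_mul 4) (V * t)
  have hintg : ∫⁻ x, g x ≤ V * (ENNReal.ofReal r ^ 2 * ∫⁻ x, ‖fderiv ℝ u x‖ₑ ^ 2) := by
    calc ∫⁻ x, g x = ∫⁻ h in Metric.ball (0 : Ed d) r, ∫⁻ x, ‖u (x + h) - u x‖ₑ ^ 2 :=
          lintegral_lintegral_swap hmeas.aemeasurable
      _ ≤ ∫⁻ h in Metric.ball (0 : Ed d) r,
            ENNReal.ofReal r ^ 2 * ∫⁻ x, ‖fderiv ℝ u x‖ₑ ^ 2 := by
          refine setLIntegral_mono measurable_const fun h hh => ?_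
          refine (lintegral_enorm_translate_sub_sq_le hu h).trans ?_
          gcongr
          rw [← ofReal_norm]
          exact ENNReal.ofReal_le_ofReal (by simpa using (mem_ball_zero_iff.1 hh).le)
      _ = _ := by simp [hV, mul_comm]
  rw [lintegral_const_mul _ hgm] at hcheb
  have h5 : V * (t * volume {x | t ≤ ‖u x‖ₑ ^ 2}) ≤
      V * (4 * (ENNReal.ofReal r ^ 2 * ∫⁻ x, ‖fderiv ℝ u x‖ₑ ^ 2)) := by
    calc _ = V * t * volume {x | t ≤ ‖u x‖ₑ ^ 2} := by ring
      _ ≤ V * t * volume {x | V * t ≤ 4 * g x} := by gcongr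
      _ ≤ 4 * ∫⁻ x, g x := hcheb
      _ ≤ 4 * (V * (ENNReal.ofReal r ^ 2 * ∫⁻ x, ‖fderiv ℝ u x‖ₑ ^ 2)) := by gcongr
      _ = _ := by ring
  exact (ENNReal.mul_le_mul_iff_right hV0 hVt).1 h5

lemma exists_meas_superlevel_le {d : ℕ} (hd : 1 ≤ d) :
    ∃ A : ℝ, 0 < A ∧ ∀ u : Ed d → ℂ, ContDiff ℝ 1 u → ∫⁻ x, ‖u x‖ₑ ^ 2 ≤ 1 →
      ∀ t : ℝ, 0 < t → volume {x | t ≤ ‖u x‖ ^ 2} ≤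
        ENNReal.ofReal (A * t ^ (-1 - 2 / (d : ℝ))) * ∫⁻ x, ‖fderiv ℝ u x‖ₑ ^ 2 := by
  have hd0 : (d : ℝ) ≠ 0 := by positivity
  have : Nonempty (Fin d) := ⟨⟨0, hd⟩⟩
  set ω := (volume (Metric.ball (0 : Ed d) 1)).toReal with hω
  have hωt : volume (Metric.ball (0 : Ed d) 1) ≠ ⊤ := measure_ball_lt_top.ne
  have hω0 : 0 < ω := ENNReal.toReal_pos (Metric.measure_ball_pos _ _ one_pos).ne' hωt
  refine ⟨4 * (4 / ω) ^ (2 / (d : ℝ)), by positivity, fun u hu h1 t ht => ?_⟩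
  set r : ℝ := (4 / (ω * t)) ^ (1 / (d : ℝ)) with hr
  have hr0 : 0 ≤ r := by positivity
  have hrd : r ^ d = 4 / (ω * t) := by
    rw [hr, ← Real.rpow_natCast, ← Real.rpow_mul (by positivity), one_div_mul_cancel hd0,
      Real.rpow_one]
  have hr2 : r ^ 2 = (4 / ω) ^ (2 / (d : ℝ)) * t ^ (-(2 / (d : ℝ))) := by
    rw [hr, ← Real.rpow_natCast, ← Real.rpow_mul (by positivity), Real.rpow_neg ht.le,
      ← Real.inv_rpow ht.le, ← Real.mul_rpow (by positivity) (by positivity)]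
    congr 1
    · field_simp
    · push_cast; ring
  have hvol : 4 ≤ volume (Metric.ball (0 : Ed d) r) * ENNReal.ofReal t := by
    rw [Measure.addHaar_ball _ _ hr0, finrank_euclideanSpace_fin, hrd,
      ← ENNReal.ofReal_toReal hωt, ← hω, ← ENNReal.ofReal_mul (by positivity),
      ← ENNReal.ofReal_mul (by positivity)]
    rw [show 4 / (ω * t) * ω * t = 4 by field_simp]
    simp
  have key := meas_superlevel_le hu h1 ENNReal.ofReal_ne_top hvol
  have hset : {x | ENNReal.ofReal t ≤ ‖u x‖ₑ ^ 2} = {x | t ≤ ‖u x‖ ^ 2} := by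
    ext x
    rw [Set.mem_ofPred_eq, Set.mem_ofPred_eq, ← ofReal_norm, ← ENNReal.ofReal_pow (norm_nonneg _),
      ENNReal.ofReal_le_ofReal_iff (by positivity)]
  rw [hset] at key
  have ht0 : ENNReal.ofReal t ≠ 0 := by simpa using ht
  rw [← ENNReal.mul_le_mul_iff_right ht0 ENNReal.ofReal_ne_top]
  refine key.trans (le_of_eq ?_)
  rw [← mul_assoc, ← mul_assoc, ← ENNReal.ofReal_mul ht.le, ← ENNReal.ofReal_pow hr0, hr2]
  congr 1
  rw [show (4 : ENNReal) = ENNReal.ofReal 4 by simp, ← ENNReal.ofReal_mul (by positivity)]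
  congr 1
  rw [show (-1 - 2 / (d : ℝ)) = -1 + -(2 / (d : ℝ)) by ring, Real.rpow_add ht, Real.rpow_neg_one]
  field_simp

lemma exists_Ioi_rpow_lintegral_le {α : ℝ} (hα : α < -1) {ε : ℝ} (hε : 0 < ε) :
    ∃ S : ℝ, 0 < S ∧ ∫⁻ t in Set.Ioi S, ENNReal.ofReal (t ^ α) ≤ ENNReal.ofReal ε := by
  have h1 : Tendsto (fun S : ℝ => -S ^ (α + 1) / (α + 1)) atTop (𝓝 0) := by
    have := tendsto_rpow_neg_atTop (y := -(α + 1)) (by linarith)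
    simpa using this.neg.div_const (α + 1)
  obtain ⟨S, hS, hS0⟩ := ((h1.eventually (eventually_lt_nhds hε)).and
    (eventually_gt_atTop 0)).exists
  refine ⟨S, hS0, ?_⟩
  rw [← ofReal_integral_eq_lintegral_ofReal (integrableOn_Ioi_rpow_of_lt hα hS0)
    ((ae_restrict_iff' measurableSet_Ioi).2 (Eventually.of_forall fun t ht =>
      Real.rpow_nonneg (hS0.le.trans (le_of_lt ht)) _)), integral_Ioi_rpow_of_lt hα hS0]
  exact ENNReal.ofReal_le_ofReal hS.le

/-- A subcritical Gagliardo–Nirenberg inequality: the `L^{2 p}` norm of a normalized function is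
controlled by an arbitrarily small multiple of its Dirichlet integral, up to a constant. -/
lemma exists_integral_rpow_le_dirichlet {d : ℕ} (hd : 1 ≤ d) {p : ℝ} (hp1 : 1 < p)
    (hp2 : p < 1 + 2 / d) {ε : ℝ} (hε : 0 < ε) :
    ∃ C : ℝ, 0 ≤ C ∧ ∀ u : Ed d → ℂ, ContDiff ℝ 1 u → Integrable (fun x => ‖u x‖ ^ 2) →
      Integrable (fun x => ‖fderiv ℝ u x‖ ^ 2) → ∫ x, ‖u x‖ ^ 2 = 1 →
      Integrable (fun x => (‖u x‖ ^ 2) ^ p) ∧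
        ∫ x, (‖u x‖ ^ 2) ^ p ≤ ε * (∫ x, ‖fderiv ℝ u x‖ ^ 2) + C := by
  obtain ⟨A, hA, hweak⟩ := exists_meas_superlevel_le hd
  have hp0 : 0 < p := by linarith
  obtain ⟨S, hS, hSε⟩ := exists_Ioi_rpow_lintegral_le (α := p - 2 - 2 / d) (by linarith)
    (ε := ε / (p * A)) (by positivity)
  set B : ENNReal := ∫⁻ t in Set.Ioc 0 S, ENNReal.ofReal (t ^ (p - 2)) with hB
  have hBt : B ≠ ⊤ := by
    have h := (intervalIntegral.intervalIntegrable_rpow' (a := 0) (b := S)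
      (r := p - 2) (by linarith)).1
    refine ne_top_of_le_ne_top h.2.ne (lintegral_mono fun t => ?_)
    rw [← ofReal_norm]
    exact ENNReal.ofReal_le_ofReal (le_abs_self _)
  refine ⟨p * B.toReal, by positivity, fun u hu hu2 hg2 hn => ?_⟩
  have hn' : ∫⁻ x, ‖u x‖ₑ ^ 2 = 1 := by
    have := ofReal_integral_eq_lintegral_ofReal hu2 (Eventually.of_forall fun x => by positivity)
    rw [hn] at this
    simpa [ENNReal.ofReal_pow, ofReal_norm] using this.symm
  set T := ∫ x, ‖fderiv ℝ u x‖ ^ 2 with hT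
  have hT0 : 0 ≤ T := integral_nonneg fun x => by positivity
  have hT' : ∫⁻ x, ‖fderiv ℝ u x‖ₑ ^ 2 = ENNReal.ofReal T := by
    have := ofReal_integral_eq_lintegral_ofReal hg2 (Eventually.of_forall fun x => by positivity)
    simpa [ENNReal.ofReal_pow, ofReal_norm] using this.symm
  have hw := hweak u hu hn'.le
  rw [hT'] at hw
  have hcheb : ∀ t : ℝ, 0 < t → volume {x | t ≤ ‖u x‖ ^ 2} ≤ ENNReal.ofReal (t ^ (-1 : ℝ)) := by
    intro t ht
    have h := mul_meas_ge_le_lintegral₀ hu2.aemeasurable.ennreal_ofReal (ENNReal.ofReal t)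
    have hset : {x | ENNReal.ofReal t ≤ ENNReal.ofReal (‖u x‖ ^ 2)} = {x | t ≤ ‖u x‖ ^ 2} := by
      ext x
      rw [Set.mem_ofPred_eq, Set.mem_ofPred_eq, ENNReal.ofReal_le_ofReal_iff (by positivity)]
    rw [hset, ← ofReal_integral_eq_lintegral_ofReal hu2
      (Eventually.of_forall fun x => by positivity), hn] at h
    have ht0 : ENNReal.ofReal t ≠ 0 := by simpa using ht
    rw [← ENNReal.mul_le_mul_iff_right ht0 ENNReal.ofReal_ne_top, ← ENNReal.ofReal_mul ht.le,
      Real.rpow_neg_one, mul_inv_cancel₀ ht.ne']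
    exact h
  have hlay := lintegral_rpow_eq_lintegral_meas_le_mul volume (f := fun x => ‖u x‖ ^ 2)
    (Eventually.of_forall fun x => by positivity) hu2.aemeasurable hp0
  have hbound : ∫⁻ x, ENNReal.ofReal ((‖u x‖ ^ 2) ^ p) ≤
      ENNReal.ofReal (ε * T + p * B.toReal) := by
    rw [hlay, ← Set.Ioc_union_Ioi_eq_Ioi hS.le, lintegral_union measurableSet_Ioi
      (Set.Ioc_disjoint_Ioi le_rfl)]
    have i1 : ∫⁻ t in Set.Ioc 0 S, volume {x | t ≤ ‖u x‖ ^ 2} * ENNReal.ofReal (t ^ (p - 1))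
        ≤ B := by
      refine setLIntegral_mono' measurableSet_Ioc fun t ht => ?_
      calc _ ≤ ENNReal.ofReal (t ^ (-1 : ℝ)) * ENNReal.ofReal (t ^ (p - 1)) := by
            gcongr; exact hcheb t ht.1
        _ = _ := by
            rw [← ENNReal.ofReal_mul (Real.rpow_nonneg ht.1.le _), ← Real.rpow_add ht.1]
            ring_nf
    have i2 : ∫⁻ t in Set.Ioi S, volume {x | t ≤ ‖u x‖ ^ 2} * ENNReal.ofReal (t ^ (p - 1))
        ≤ ENNReal.ofReal (A * T) * ENNReal.ofReal (ε / (p * A)) := by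
      calc _ ≤ ∫⁻ t in Set.Ioi S, ENNReal.ofReal (A * T) *
              ENNReal.ofReal (t ^ (p - 2 - 2 / (d : ℝ))) := by
            refine setLIntegral_mono' measurableSet_Ioi fun t ht => ?_
            have ht0 : 0 < t := hS.trans ht
            calc _ ≤ ENNReal.ofReal (A * t ^ (-1 - 2 / (d : ℝ))) * ENNReal.ofReal T *
                    ENNReal.ofReal (t ^ (p - 1)) := by
                  gcongr; exact hw t ht0
              _ = _ := by
                  rw [← ENNReal.ofReal_mul (by positivity), ← ENNReal.ofReal_mul (by positivity),
                    ← ENNReal.ofReal_mul (by positivity)]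
                  congr 1
                  rw [show p - 2 - 2 / (d : ℝ) = (-1 - 2 / (d : ℝ)) + (p - 1) by ring,
                    Real.rpow_add ht0]
                  ring
        _ ≤ _ := by
            rw [lintegral_const_mul' _ _ ENNReal.ofReal_ne_top]
            gcongr
    calc _ ≤ ENNReal.ofReal p * (B + ENNReal.ofReal (A * T) * ENNReal.ofReal (ε / (p * A))) := by
          gcongr
      _ = _ := by
          rw [← ENNReal.ofReal_toReal hBt, ← ENNReal.ofReal_mul (by positivity),
            ← ENNReal.ofReal_add (by positivity) (by positivity),
            ← ENNReal.ofReal_mul (by positivity), ENNReal.toReal_ofReal (by positivity)]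
          congr 1
          field_simp
          ring
  have hmeas : AEStronglyMeasurable (fun x => (‖u x‖ ^ 2) ^ p) volume :=
    (Continuous.rpow_const (by have := hu.continuous; fun_prop)
      fun _ => Or.inr hp0.le).aestronglyMeasurable
  have hintg : Integrable (fun x => (‖u x‖ ^ 2) ^ p) := by
    refine ⟨hmeas, ?_⟩
    rw [hasFiniteIntegral_iff_ofReal (Eventually.of_forall fun x => by positivity)]
    exact hbound.trans_lt ENNReal.ofReal_lt_top
  refine ⟨hintg, ?_⟩
  rw [← ofReal_integral_eq_lintegral_ofReal hintg (Eventually.of_forall fun x => by positivity),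
    ENNReal.ofReal_le_ofReal_iff (by positivity)] at hbound
  exact hbound

lemma Admissible.integral_norm_sq {d N : ℕ} {u : Fin N → Ed d → ℂ} (hu : Admissible d N u)
    (n : Fin N) : ∫ x, ‖u n x‖ ^ 2 = 1 := by
  have h := hu.orthonormal n n
  simp only [Complex.mul_conj, Complex.normSq_eq_norm_sq, if_true] at h
  rw [integral_complex_ofReal] at h
  exact_mod_cast h

lemma Admissible.comp_injective {d M N : ℕ} {u : Fin M → Ed d → ℂ} (hu : Admissible d M u)
    {f : Fin N → Fin M} (hf : Function.Injective f) : Admissible d N (u ∘ f) where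
  contDiff n := hu.contDiff (f n)
  sqInt n := hu.sqInt (f n)
  gradSqInt n := hu.gradSqInt (f n)
  orthonormal j k := by simpa [hf.eq_iff] using hu.orthonormal (f j) (f k)

/-- The energy of a tuple with arbitrary occupation weights. -/
def occEnergy {d : ℕ} {ι : Type*} [Fintype ι] (p : ℝ) (w : ι → ℝ) (u : ι → Ed d → ℂ) : ℝ :=
  (∑ n, w n * ∫ x : Ed d, ‖fderiv ℝ (u n) x‖ ^ 2)
    - (1 / p) * ∫ x : Ed d, (∑ n, w n * ‖u n x‖ ^ 2) ^ p

lemma energyW_eq_occEnergy (d N : ℕ) (p lam : ℝ) (u : Fin N → Ed d → ℂ) :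
    energyW d N p lam u = occEnergy p (wt N lam) u := rfl

lemma occEnergy_comp_injective {d M N : ℕ} {p : ℝ} {w : Fin M → ℝ} {u : Fin M → Ed d → ℂ}
    {f : Fin N → Fin M} (hf : Function.Injective f) (hw : ∀ m, m ∉ Set.range f → w m = 0) :
    occEnergy p (w ∘ f) (u ∘ f) = occEnergy p w u := by
  have key : ∀ g : Fin M → ℝ, ∑ n, w (f n) * g (f n) = ∑ m, w m * g m := fun g =>
    Fintype.sum_of_injective f hf _ _ (fun m hm => by simp [hw m hm]) fun _ => rfl
  simp only [occEnergy, Function.comp_apply]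
  rw [key fun m => ∫ x : Ed d, ‖fderiv ℝ (u m) x‖ ^ 2]
  congr 2
  refine integral_congr_ae (Eventually.of_forall fun x => ?_)
  exact congrArg (· ^ p) (key fun m => ‖u m x‖ ^ 2)

lemma occDensity_rpow_le {d N : ℕ} {p : ℝ} (hp1 : 1 < p) (u : Fin N → Ed d → ℂ)
    {w : Fin N → ℝ} (hw : ∀ n, 0 ≤ w n) (x : Ed d) :
    (∑ n, w n * ‖u n x‖ ^ 2) ^ p ≤
      (N : ℝ) ^ (p - 1) * ∑ n, w n ^ p * (‖u n x‖ ^ 2) ^ p := by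
  have := Real.rpow_sum_le_const_mul_sum_rpow_of_nonneg Finset.univ hp1.le
    (f := fun n => w n * ‖u n x‖ ^ 2) fun n _ => mul_nonneg (hw n) (by positivity)
  simpa [Real.mul_rpow (hw _)] using this

lemma Admissible.integrable_occDensity_rpow {d N : ℕ} (hd : 1 ≤ d) {p : ℝ} (hp1 : 1 < p)
    (hp2 : p < 1 + 2 / d) {u : Fin N → Ed d → ℂ} (hu : Admissible d N u)
    {w : Fin N → ℝ} (hw : ∀ n, 0 ≤ w n) :
    Integrable fun x => (∑ n, w n * ‖u n x‖ ^ 2) ^ p := by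
  obtain ⟨C, -, hC⟩ := exists_integral_rpow_le_dirichlet hd hp1 hp2 one_pos
  have hintg n := (hC (u n) (hu.contDiff n) (hu.sqInt n) (hu.gradSqInt n)
    (hu.integral_norm_sq n)).1
  refine Integrable.mono' ((integrable_finsetSum Finset.univ
    fun n _ => (hintg n).const_mul (w n ^ p)).const_mul ((N : ℝ) ^ (p - 1))) ?_ ?_
  · have hc n := (hu.contDiff n).continuous
    exact (Continuous.rpow_const (by fun_prop)
      fun _ => Or.inr (by linarith)).aestronglyMeasurable
  · refine Eventually.of_forall fun x => ?_
    rw [Real.norm_of_nonneg (Real.rpow_nonneg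
      (Finset.sum_nonneg fun n _ => mul_nonneg (hw n) (by positivity)) _)]
    exact occDensity_rpow_le hp1 u hw x

lemma exists_le_occEnergy {d : ℕ} (hd : 1 ≤ d) {p : ℝ} (hp1 : 1 < p) (hp2 : p < 1 + 2 / d)
    (N : ℕ) : ∃ B : ℝ, ∀ u : Fin N → Ed d → ℂ, Admissible d N u → ∀ w : Fin N → ℝ,
      (∀ n, 0 ≤ w n) → (∀ n, w n ≤ 1) → B ≤ occEnergy p w u := by
  set K : ℝ := (N : ℝ) ^ (p - 1) + 1 with hK
  have hp0 : 0 < p := by linarith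
  have hK0 : 0 < K := by positivity
  obtain ⟨C, hC0, hC⟩ := exists_integral_rpow_le_dirichlet hd hp1 hp2 (inv_pos.2 hK0)
  refine ⟨-(N * (K * C)), fun u hu w hw0 hw1 => ?_⟩
  have hg n := hC (u n) (hu.contDiff n) (hu.sqInt n) (hu.gradSqInt n) (hu.integral_norm_sq n)
  set T : Fin N → ℝ := fun n => ∫ x, ‖fderiv ℝ (u n) x‖ ^ 2 with hT
  set P : Fin N → ℝ := fun n => ∫ x, (‖u n x‖ ^ 2) ^ p with hP
  have hP0 n : 0 ≤ P n := integral_nonneg fun x => by positivity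
  have h1 : ∫ x, (∑ n, w n * ‖u n x‖ ^ 2) ^ p ≤ K * ∑ n, w n * P n := by
    calc _ ≤ ∫ x, (N : ℝ) ^ (p - 1) * ∑ n, w n ^ p * (‖u n x‖ ^ 2) ^ p :=
          integral_mono (hu.integrable_occDensity_rpow hd hp1 hp2 hw0)
            ((integrable_finsetSum _ fun n _ => (hg n).1.const_mul _).const_mul _)
            fun x => occDensity_rpow_le hp1 u hw0 x
      _ = (N : ℝ) ^ (p - 1) * ∑ n, w n ^ p * P n := by
          rw [integral_const_mul, integral_finsetSum _ fun n _ => (hg n).1.const_mul _]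
          simp only [integral_const_mul, hP]
      _ ≤ K * ∑ n, w n * P n := by
          have : ∀ n, w n ^ p ≤ w n := fun n => by
            simpa using Real.rpow_le_rpow_of_exponent_ge' (hw0 n) (hw1 n) zero_le_one hp1.le
          refine mul_le_mul (by linarith) (Finset.sum_le_sum fun n _ =>
            mul_le_mul_of_nonneg_right (this n) (hP0 n)) (Finset.sum_nonneg fun n _ =>
            mul_nonneg (Real.rpow_nonneg (hw0 n) _) (hP0 n)) hK0.le
  have h2 : ∀ n, w n * (K * P n) ≤ w n * T n + K * C := by
    intro n
    have h3 : K * P n ≤ T n + K * C := by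
      calc K * P n ≤ K * (K⁻¹ * T n + C) := by gcongr; exact (hg n).2
        _ = _ := by field_simp
    have : w n * (K * C) ≤ K * C := mul_le_of_le_one_left (by positivity) (hw1 n)
    nlinarith [mul_le_mul_of_nonneg_left h3 (hw0 n)]
  have h4 : K * ∑ n, w n * P n ≤ ∑ n, w n * T n + N * (K * C) := by
    calc K * ∑ n, w n * P n = ∑ n, w n * (K * P n) := by
          rw [Finset.mul_sum]; exact Finset.sum_congr rfl fun n _ => by ring
      _ ≤ ∑ n, (w n * T n + K * C) := Finset.sum_le_sum fun n _ => h2 n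
      _ = _ := by simp [Finset.sum_add_distrib]
  have h5 : 0 ≤ ∫ x, (∑ n, w n * ‖u n x‖ ^ 2) ^ p := integral_nonneg fun x =>
    Real.rpow_nonneg (Finset.sum_nonneg fun n _ => mul_nonneg (hw0 n) (by positivity)) _
  have h6 : (1 / p) * ∫ x, (∑ n, w n * ‖u n x‖ ^ 2) ^ p ≤
      ∫ x, (∑ n, w n * ‖u n x‖ ^ 2) ^ p :=
    mul_le_of_le_one_left h5 ((div_le_one hp0).2 hp1.le)
  simp only [occEnergy]
  linarith

lemma Admissible.concaveOn_occEnergy {d N : ℕ} (hd : 1 ≤ d) {p : ℝ} (hp1 : 1 < p)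
    (hp2 : p < 1 + 2 / d) {u : Fin N → Ed d → ℂ} (hu : Admissible d N u) :
    ConcaveOn ℝ {w : Fin N → ℝ | ∀ n, 0 ≤ w n} fun w => occEnergy p w u := by
  have hconv : Convex ℝ {w : Fin N → ℝ | ∀ n, 0 ≤ w n} := fun v hv w hw a b ha hb _ n =>
    add_nonneg (mul_nonneg ha (hv n)) (mul_nonneg hb (hw n))
  refine ⟨hconv, fun v hv w hw a b ha hb hab => ?_⟩
  have hi := fun {w : Fin N → ℝ} (hw : ∀ n, 0 ≤ w n) =>
    hu.integrable_occDensity_rpow hd hp1 hp2 hw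
  have h1 : ∫ x, (∑ n, (a • v + b • w) n * ‖u n x‖ ^ 2) ^ p ≤
      a * (∫ x, (∑ n, v n * ‖u n x‖ ^ 2) ^ p) + b * ∫ x, (∑ n, w n * ‖u n x‖ ^ 2) ^ p := by
    rw [← integral_const_mul, ← integral_const_mul,
      ← integral_add ((hi hv).const_mul _) ((hi hw).const_mul _)]
    refine integral_mono (hi (hconv hv hw ha hb hab))
      (((hi hv).const_mul _).add ((hi hw).const_mul _)) fun x => ?_
    have := (convexOn_rpow hp1.le).2 (x := ∑ n, v n * ‖u n x‖ ^ 2)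
      (Finset.sum_nonneg fun n _ => mul_nonneg (hv n) (by positivity))
      (y := ∑ n, w n * ‖u n x‖ ^ 2)
      (Finset.sum_nonneg fun n _ => mul_nonneg (hw n) (by positivity)) ha hb hab
    simp only [smul_eq_mul] at this
    convert this using 2
    simp only [Finset.mul_sum, ← Finset.sum_add_distrib, Pi.add_apply, Pi.smul_apply, smul_eq_mul]
    exact Finset.sum_congr rfl fun n _ => by ring
  have h2 : ∑ n, (a • v + b • w) n * ∫ x : Ed d, ‖fderiv ℝ (u n) x‖ ^ 2 =
      a * (∑ n, v n * ∫ x : Ed d, ‖fderiv ℝ (u n) x‖ ^ 2) +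
        b * ∑ n, w n * ∫ x : Ed d, ‖fderiv ℝ (u n) x‖ ^ 2 := by
    simp only [Finset.mul_sum, ← Finset.sum_add_distrib, Pi.add_apply, Pi.smul_apply, smul_eq_mul]
    exact Finset.sum_congr rfl fun n _ => by ring
  have hp0 : 0 ≤ 1 / p := by positivity
  simp only [occEnergy, smul_eq_mul]
  rw [h2]
  linarith [mul_le_mul_of_nonneg_left h1 hp0]

lemma exists_normalized_bump (d : ℕ) {p : ℝ} (hp : 0 < p) :
    ∃ ψ : Ed d → ℂ, ContDiff ℝ 1 ψ ∧ HasCompactSupport ψ ∧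
      (∀ x, 1 < ‖x‖ → ψ x = 0 ∧ fderiv ℝ ψ x = 0) ∧
      ∫ x, ‖ψ x‖ ^ 2 = 1 ∧ 0 < ∫ x, (‖ψ x‖ ^ 2) ^ p := by
  let φ : ContDiffBump (0 : Ed d) := ⟨1 / 2, 1, by norm_num, by norm_num⟩
  have hφ : Continuous φ := φ.continuous
  have hφ0 : φ 0 = 1 := φ.one_of_mem_closedBall (by simp [φ])
  have hcs : HasCompactSupport fun x => ‖φ x‖ ^ 2 :=
    φ.hasCompactSupport.comp_left (g := fun y : ℝ => ‖y‖ ^ 2) (by simp)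
  set A := ∫ x, ‖φ x‖ ^ 2 with hA
  have hA0 : 0 < A := Continuous.integral_pos_of_hasCompactSupport_nonneg_nonzero
    (by fun_prop) hcs (fun x => by positivity) (x := 0) (by simp [hφ0])
  set ψ : Ed d → ℂ := fun x => (((√A)⁻¹ * φ x : ℝ) : ℂ) with hψ
  have hψd : ContDiff ℝ 1 ψ :=
    Complex.ofRealCLM.contDiff.comp (contDiff_const.mul φ.contDiff)
  have hψs : HasCompactSupport ψ := φ.hasCompactSupport.comp_left
    (g := fun y : ℝ => (((√A)⁻¹ * y : ℝ) : ℂ)) (by simp)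
  have hts : tsupport ψ ⊆ Metric.closedBall 0 1 := by
    refine (tsupport_comp_subset (g := fun y : ℝ => (((√A)⁻¹ * y : ℝ) : ℂ)) (by simp) φ).trans ?_
    exact φ.tsupport_eq.subset
  have hn : ∀ x, ‖ψ x‖ ^ 2 = A⁻¹ * ‖φ x‖ ^ 2 := by
    intro x
    rw [hψ, Complex.norm_real, norm_mul, mul_pow, norm_inv, inv_pow,
      Real.norm_of_nonneg (Real.sqrt_nonneg A), Real.sq_sqrt hA0.le]
  refine ⟨ψ, hψd, hψs, fun x hx => ?_, ?_, ?_⟩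
  · have hx' : x ∉ tsupport ψ := fun h => by
      have := mem_closedBall_zero_iff.1 (hts h)
      linarith
    exact ⟨image_eq_zero_of_notMem_tsupport hx', fderiv_of_notMem_tsupport (𝕜 := ℝ) hx'⟩
  · simp only [hn, integral_const_mul]
    exact inv_mul_cancel₀ hA0.ne'
  · have hψ0 : ‖ψ 0‖ ^ 2 ≠ 0 := by
      rw [hn, hφ0]; simp [hA0.ne']
    refine Continuous.integral_pos_of_hasCompactSupport_nonneg_nonzero
      (Continuous.rpow_const (by have := hψd.continuous; fun_prop) fun _ => Or.inr hp.le)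
      (hψs.comp_left (g := fun z : ℂ => (‖z‖ ^ 2) ^ p) (by simp [hp.ne']))
      (fun x => by positivity) (x := 0) ?_
    exact (Real.rpow_pos_of_pos (by positivity) p).ne'

lemma integral_comp_smul_sub {d : ℕ} (f : Ed d → ℝ) {s : ℝ} (hs : 0 < s) (a : Ed d) :
    ∫ x, f (s • x - a) = (s ^ d)⁻¹ * ∫ x, f x := by
  rw [Measure.integral_comp_smul volume (fun x => f (x - a)) s, integral_sub_right_eq_self f a,
    finrank_euclideanSpace_fin, abs_of_pos (by positivity), smul_eq_mul]

/-- Disjointly supported translates of a spread-out bump have negative energy. -/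
lemma exists_disjoint_test_family {d : ℕ} (hd : 1 ≤ d) {p : ℝ} (hp1 : 1 < p)
    (hp2 : p < 1 + 2 / d) (m : ℕ) {K : ℝ} (hK : 0 < K) :
    ∃ (v : Fin m → Ed d → ℂ) (T P : ℝ), T < K * P ∧
      (∀ i, ContDiff ℝ 1 (v i)) ∧ (∀ i, HasCompactSupport (v i)) ∧
      (∀ i, ∫ x, ‖v i x‖ ^ 2 = 1) ∧ (∀ i, ∫ x, ‖fderiv ℝ (v i) x‖ ^ 2 = T) ∧
      (∀ i, ∫ x, (‖v i x‖ ^ 2) ^ p = P) ∧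
      (∀ x i j, i ≠ j → v i x = 0 ∨ v j x = 0) ∧
      (∀ x i j, i ≠ j → fderiv ℝ (v i) x = 0 ∨ fderiv ℝ (v j) x = 0) := by
  obtain ⟨ψ, hψd, hψs, hψ0, hψn, hψp⟩ := exists_normalized_bump d (p := p) (by linarith)
  have hd0 : (0 : ℝ) < d := by positivity
  set T₀ := ∫ x, ‖fderiv ℝ ψ x‖ ^ 2
  set P₀ := ∫ x, (‖ψ x‖ ^ 2) ^ p
  have hβ : 0 < 2 - d * (p - 1) := by
    have : p - 1 < 2 / d := by linarith
    rw [lt_div_iff₀ hd0] at this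
    linarith
  obtain ⟨s, hsT, hs⟩ : ∃ s : ℝ, s ^ (2 - d * (p - 1)) * T₀ < K * P₀ ∧ 0 < s := by
    have h1 : Tendsto (fun s : ℝ => s ^ (2 - d * (p - 1)) * T₀) (𝓝[>] 0) (𝓝 0) := by
      have := ((Real.continuousAt_rpow_const 0 _ (Or.inr hβ.le)).tendsto.mul_const T₀)
      rw [Real.zero_rpow hβ.ne', zero_mul] at this
      exact this.mono_left nhdsWithin_le_nhds
    exact ((h1.eventually (eventually_lt_nhds (by positivity))).and
      self_mem_nhdsWithin).exists
  set e : Ed d := EuclideanSpace.single ⟨0, hd⟩ 1 with he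
  have hen : ‖e‖ = 1 := by simp [he]
  set a : Fin m → Ed d := fun i => (3 * (i : ℝ)) • e with ha
  set c : ℝ := s ^ ((d : ℝ) / 2) with hc
  have hc0 : 0 < c := by positivity
  have hc2 : c ^ 2 = s ^ d := by
    rw [hc, ← Real.rpow_natCast, ← Real.rpow_mul hs.le, ← Real.rpow_natCast]
    congr 1; push_cast; ring
  set v : Fin m → Ed d → ℂ := fun i x => c • ψ (s • x - a i) with hv
  have hfd : ∀ i x, fderiv ℝ (v i) x = (c * s) • fderiv ℝ ψ (s • x - a i) := by
    intro i x
    have h1 : HasFDerivAt (fun x : Ed d => s • x - a i) (s • ContinuousLinearMap.id ℝ (Ed d)) x :=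
      ((hasFDerivAt_id x).const_smul s).sub_const _
    have h2 := (((hψd.differentiable one_ne_zero) (s • x - a i)).hasFDerivAt.comp x h1).const_smul c
    refine h2.fderiv.trans ?_
    ext y
    simp [mul_assoc]
  have hdisj : ∀ x i j, i ≠ j → 1 < ‖s • x - a i‖ ∨ 1 < ‖s • x - a j‖ := by
    intro x i j hij
    by_contra! h
    have h1 : ‖a i - a j‖ ≤ 2 := by
      have := norm_sub_le (s • x - a j) (s • x - a i)
      rw [sub_sub_sub_cancel_left] at this
      linarith
    rw [ha, ← sub_smul, norm_smul, hen, mul_one, ← mul_sub, norm_mul] at h1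
    have h2 : (1 : ℝ) ≤ ‖(i : ℝ) - j‖ := by
      have : (1 : ℤ) ≤ |(i : ℤ) - j| := Int.one_le_abs (by
        intro h; apply hij; ext; omega)
      rw [Real.norm_eq_abs]
      exact_mod_cast this
    norm_num at h1
    norm_num at h2
    linarith
  have hsd : s ^ d ≠ 0 := by positivity
  have hnv : ∀ i x, ‖v i x‖ ^ 2 = s ^ d * ‖ψ (s • x - a i)‖ ^ 2 := by
    intro i x
    rw [hv, norm_smul, mul_pow, Real.norm_of_nonneg hc0.le, hc2]
  refine ⟨v, s ^ 2 * T₀, s ^ (d * (p - 1)) * P₀, ?_, ?_, ?_, ?_, ?_, ?_, ?_, ?_⟩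
  · have h1 : s ^ 2 = s ^ (d * (p - 1)) * s ^ (2 - d * (p - 1)) := by
      rw [← Real.rpow_add hs, ← Real.rpow_natCast]
      congr 1; push_cast; ring
    rw [h1]
    have h2 : 0 < s ^ (d * (p - 1)) := by positivity
    nlinarith [mul_lt_mul_of_pos_left hsT h2]
  · intro i
    exact ContDiff.const_smul c (hψd.comp ((contDiff_id.const_smul s).sub contDiff_const))
  · intro i
    have h1 : HasCompactSupport fun x : Ed d => ψ (s • x - a i) := by
      have := (hψs.comp_homeomorph (Homeomorph.subRight (a i))).comp_smul hs.ne'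
      exact this
    exact h1.smul_left (f := fun _ => c)
  · intro i
    simp only [hnv, integral_const_mul]
    rw [integral_comp_smul_sub (fun x => ‖ψ x‖ ^ 2) hs, hψn]
    field_simp
  · intro i
    have h1 : ∀ x, ‖fderiv ℝ (v i) x‖ ^ 2 =
        s ^ d * s ^ 2 * ‖fderiv ℝ ψ (s • x - a i)‖ ^ 2 := by
      intro x
      rw [hfd, norm_smul, mul_pow, Real.norm_of_nonneg (by positivity), mul_pow, hc2]
    simp only [h1, integral_const_mul]
    rw [integral_comp_smul_sub (fun x => ‖fderiv ℝ ψ x‖ ^ 2) hs]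
    field_simp
    rfl
  · intro i
    have h1 : ∀ x, (‖v i x‖ ^ 2) ^ p = (s ^ d) ^ p * (‖ψ (s • x - a i)‖ ^ 2) ^ p := by
      intro x
      rw [hnv, Real.mul_rpow (by positivity) (by positivity)]
    simp only [h1, integral_const_mul]
    rw [integral_comp_smul_sub (fun x => (‖ψ x‖ ^ 2) ^ p) hs, ← mul_assoc]
    congr 1
    rw [← Real.rpow_natCast, ← Real.rpow_neg hs.le, ← Real.rpow_mul hs.le, ← Real.rpow_add hs]
    congr 1; ring
  · intro x i j hij
    rcases hdisj x i j hij with h | h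
    · left; simp [hv, (hψ0 _ h).1]
    · right; simp [hv, (hψ0 _ h).1]
  · intro x i j hij
    rcases hdisj x i j hij with h | h
    · left; rw [hfd, (hψ0 _ h).2]; exact smul_zero (A := Ed d →L[ℝ] ℂ) (c * s)
    · right; rw [hfd, (hψ0 _ h).2]; exact smul_zero (A := Ed d →L[ℝ] ℂ) (c * s)

lemma map_sum_of_pairwise_zero {ι E : Type*} [Fintype ι] [AddCommMonoid E] {z : ι → E}
    (hz : ∀ i j, i ≠ j → z i = 0 ∨ z j = 0) {g : E → ℝ} (hg : g 0 = 0) :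
    g (∑ i, z i) = ∑ i, g (z i) := by
  by_cases h : ∃ i, z i ≠ 0
  · obtain ⟨i, hi⟩ := h
    have hj : ∀ j, j ≠ i → z j = 0 := fun j hji => (hz j i hji).resolve_right hi
    rw [Finset.sum_eq_single i (fun j _ h => hj j h) (by simp),
      Finset.sum_eq_single i (fun j _ h => by rw [hj j h, hg]) (by simp)]
  · push Not at h
    simp [h, hg]

lemma exists_unit_orthogonal {M : ℕ} (B : Fin M → Fin (M + 1) → ℂ) :
    ∃ c : Fin (M + 1) → ℂ, ∑ i, ‖c i‖ ^ 2 = 1 ∧ ∀ j, ∑ i, c i * B j i = 0 := by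
  have hker : LinearMap.ker (Matrix.mulVecLin (Matrix.of B)) ≠ ⊥ :=
    LinearMap.ker_ne_bot_of_finrank_lt (by simp)
  obtain ⟨c, hc, hc0⟩ := Submodule.exists_mem_ne_zero_of_ne_bot hker
  set A := ∑ i, ‖c i‖ ^ 2 with hA
  have hA0 : 0 < A := by
    obtain ⟨i, hi⟩ := Function.ne_iff.1 hc0
    refine Finset.sum_pos' (fun i _ => by positivity) ⟨i, Finset.mem_univ _, ?_⟩
    have : c i ≠ 0 := hi
    positivity
  refine ⟨fun i => ((√A)⁻¹ : ℝ) * c i, ?_, fun j => ?_⟩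
  · simp only [norm_mul, mul_pow, Complex.norm_real, norm_inv, inv_pow,
      Real.norm_of_nonneg (Real.sqrt_nonneg A), Real.sq_sqrt hA0.le, ← Finset.mul_sum]
    exact inv_mul_cancel₀ hA0.ne'
  · have h := congrFun (LinearMap.mem_ker.1 hc) j
    simp only [Matrix.mulVecLin_apply, Matrix.mulVec, dotProduct, Matrix.of_apply,
      Pi.zero_apply] at h
    simp only [mul_assoc, ← Finset.mul_sum]
    simp only [mul_comm (c _), h, mul_zero]

lemma Admissible.snoc {d M : ℕ} {u : Fin M → Ed d → ℂ} (hu : Admissible d M u) {w : Ed d → ℂ}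
    (hw : ContDiff ℝ 1 w) (hw2 : Integrable fun x => ‖w x‖ ^ 2)
    (hwg : Integrable fun x => ‖fderiv ℝ w x‖ ^ 2) (hwn : ∫ x, ‖w x‖ ^ 2 = 1)
    (hwu : ∀ j, ∫ x, w x * (starRingEnd ℂ) (u j x) = 0) :
    Admissible d (M + 1) (Fin.snoc (α := fun _ => Ed d → ℂ) u w) where
  contDiff n := by
    refine Fin.lastCases ?_ (fun i => ?_) n
    · simpa using hw
    · simpa using hu.contDiff i
  sqInt n := by
    refine Fin.lastCases ?_ (fun i => ?_) n
    · simpa using hw2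
    · simpa using hu.sqInt i
  gradSqInt n := by
    refine Fin.lastCases ?_ (fun i => ?_) n
    · simpa using hwg
    · simpa using hu.gradSqInt i
  orthonormal j k := by
    refine Fin.lastCases ?_ (fun j => ?_) j <;> refine Fin.lastCases ?_ (fun k => ?_) k
    · simp only [Fin.snoc_last, if_true, Complex.mul_conj, Complex.normSq_eq_norm_sq]
      rw [integral_complex_ofReal, hwn, Complex.ofReal_one]
    · simpa [(Fin.castSucc_lt_last k).ne'] using hwu k
    · have h := congrArg (starRingEnd ℂ) (hwu j)
      rw [← integral_conj] at h
      simpa [(Fin.castSucc_lt_last j).ne, mul_comm] using h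
    · simpa using hu.orthonormal j k

/-- Any admissible tuple can be extended by one orbital of occupation `μ` whose own energy is
negative, with a bound depending only on the length of the tuple. -/
lemma exists_extension_energy_le {d : ℕ} (hd : 1 ≤ d) {p : ℝ} (hp1 : 1 < p)
    (hp2 : p < 1 + 2 / d) (M : ℕ) {μ : ℝ} (hμ : 0 < μ) :
    ∃ δ : ℝ, 0 < δ ∧ ∀ u : Fin M → Ed d → ℂ, Admissible d M u → ∃ w : Ed d → ℂ,
      Admissible d (M + 1) (Fin.snoc (α := fun _ => Ed d → ℂ) u w) ∧
      Integrable (fun x => (μ * ‖w x‖ ^ 2) ^ p) ∧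
      μ * (∫ x, ‖fderiv ℝ w x‖ ^ 2) - (1 / p) * ∫ x, (μ * ‖w x‖ ^ 2) ^ p ≤ -δ := by
  have hp0 : 0 < p := by linarith
  set L : ℝ := ((M + 1 : ℕ) : ℝ) ^ (p - 1) with hL
  have hL0 : 0 < L := by positivity
  obtain ⟨v, T, P, hTP, hvd, hvs, hvn, hvT, hvP, hdisj, hdisj'⟩ :=
    exists_disjoint_test_family hd hp1 hp2 (M + 1) (K := (1 / p) * μ ^ (p - 1) * L⁻¹)
      (by positivity)
  refine ⟨μ * ((1 / p) * μ ^ (p - 1) * L⁻¹ * P - T), mul_pos hμ (by linarith), fun u hu => ?_⟩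
  obtain ⟨c, hc1, hc⟩ := exists_unit_orthogonal
    fun j i => ∫ x, v i x * (starRingEnd ℂ) (u j x)
  have hvc i := (hvd i).continuous
  have hvfc i := (hvd i).continuous_fderiv one_ne_zero
  have hP0 : 0 ≤ P := by
    rw [← hvP 0]; exact integral_nonneg fun x => by positivity
  have hi2 i : Integrable fun x => ‖v i x‖ ^ 2 := Continuous.integrable_of_hasCompactSupport
    (by fun_prop) ((hvs i).comp_left (g := fun z : ℂ => ‖z‖ ^ 2) (by simp))
  have hiT i : Integrable fun x => ‖fderiv ℝ (v i) x‖ ^ 2 :=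
    Continuous.integrable_of_hasCompactSupport ((hvfc i).norm.pow 2)
      (((hvs i).fderiv ℝ).comp_left (g := fun z : Ed d →L[ℝ] ℂ => ‖z‖ ^ 2) (by simp))
  have hiP i : Integrable fun x => (‖v i x‖ ^ 2) ^ p :=
    Continuous.integrable_of_hasCompactSupport
      (Continuous.rpow_const (by fun_prop) fun _ => Or.inr hp0.le)
      ((hvs i).comp_left (g := fun z : ℂ => (‖z‖ ^ 2) ^ p) (by simp [hp0.ne']))
  have hiu i j : Integrable fun x => v i x * (starRingEnd ℂ) (u j x) :=
    Continuous.integrable_of_hasCompactSupport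
      ((hvc i).mul (Complex.continuous_conj.comp (hu.contDiff j).continuous))
      ((hvs i).mul_right)
  set w : Ed d → ℂ := fun x => ∑ i, c i * v i x with hw
  have hwd : ContDiff ℝ 1 w := ContDiff.sum fun i _ => contDiff_const.mul (hvd i)
  have hwf x : fderiv ℝ w x = ∑ i, c i • fderiv ℝ (v i) x := by
    rw [hw, fderiv_fun_sum fun i _ =>
      (((hvd i).differentiable one_ne_zero) x).const_mul (c i)]
    exact Finset.sum_congr rfl fun i _ =>
      fderiv_const_mul (((hvd i).differentiable one_ne_zero) x) (c i)
  have hz x : ∀ i j, i ≠ j → c i * v i x = 0 ∨ c j * v j x = 0 := fun i j hij =>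
    (hdisj x i j hij).imp (fun h => by rw [h, mul_zero]) fun h => by rw [h, mul_zero]
  have hw2 x : ‖w x‖ ^ 2 = ∑ i, ‖c i‖ ^ 2 * ‖v i x‖ ^ 2 := by
    have := map_sum_of_pairwise_zero (hz x) (g := fun z : ℂ => ‖z‖ ^ 2) (by simp)
    simpa [hw, mul_pow] using this
  have hwP x : (‖w x‖ ^ 2) ^ p = ∑ i, (‖c i‖ ^ 2) ^ p * (‖v i x‖ ^ 2) ^ p := by
    have := map_sum_of_pairwise_zero (hz x) (g := fun z : ℂ => (‖z‖ ^ 2) ^ p) (by simp [hp0.ne'])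
    simpa [hw, mul_pow, Real.mul_rpow] using this
  have hwT x : ‖fderiv ℝ w x‖ ^ 2 = ∑ i, ‖c i‖ ^ 2 * ‖fderiv ℝ (v i) x‖ ^ 2 := by
    have := map_sum_of_pairwise_zero (z := fun i => c i • fderiv ℝ (v i) x)
      (fun i j hij => (hdisj' x i j hij).imp
        (fun h => by rw [h]; exact smul_zero (A := Ed d →L[ℝ] ℂ) (c i))
        fun h => by rw [h]; exact smul_zero (A := Ed d →L[ℝ] ℂ) (c j))
      (g := fun z : Ed d →L[ℝ] ℂ => ‖z‖ ^ 2) (by simp)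
    rw [hwf]
    simpa [norm_smul, mul_pow] using this
  have hwi2 : Integrable fun x => ‖w x‖ ^ 2 := by
    simp only [hw2]; exact integrable_finsetSum _ fun i _ => (hi2 i).const_mul _
  have hwiT : Integrable fun x => ‖fderiv ℝ w x‖ ^ 2 := by
    simp only [hwT]; exact integrable_finsetSum _ fun i _ => (hiT i).const_mul _
  have hwn : ∫ x, ‖w x‖ ^ 2 = 1 := by
    simp only [hw2]
    rw [integral_finsetSum _ fun i _ => (hi2 i).const_mul _]
    simp only [integral_const_mul, hvn, mul_one, hc1]
  have hwTT : ∫ x, ‖fderiv ℝ w x‖ ^ 2 = T := by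
    simp only [hwT]
    rw [integral_finsetSum _ fun i _ => (hiT i).const_mul _]
    simp only [integral_const_mul, hvT, ← Finset.sum_mul, hc1, one_mul]
  have hwiP : Integrable fun x => (‖w x‖ ^ 2) ^ p := by
    simp only [hwP]; exact integrable_finsetSum _ fun i _ => (hiP i).const_mul _
  have hwPP : L⁻¹ * P ≤ ∫ x, (‖w x‖ ^ 2) ^ p := by
    simp only [hwP]
    rw [integral_finsetSum _ fun i _ => (hiP i).const_mul _]
    simp only [integral_const_mul, hvP, ← Finset.sum_mul]
    have h := Real.rpow_sum_le_const_mul_sum_rpow_of_nonneg Finset.univ hp1.le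
      (f := fun i => ‖c i‖ ^ 2) fun n _ => by positivity
    rw [hc1, Real.one_rpow, Finset.card_univ, Fintype.card_fin, ← hL] at h
    gcongr
    rwa [inv_le_iff_one_le_mul₀' hL0]
  have hμw x : (μ * ‖w x‖ ^ 2) ^ p = μ ^ p * (‖w x‖ ^ 2) ^ p :=
    Real.mul_rpow hμ.le (by positivity)
  refine ⟨w, hu.snoc hwd hwi2 hwiT hwn fun j => ?_, ?_, ?_⟩
  · simp only [hw, Finset.sum_mul, mul_assoc]
    rw [integral_finsetSum _ fun i _ => (hiu i j).const_mul _]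
    simpa only [integral_const_mul] using hc j
  · simp only [hμw]; exact hwiP.const_mul _
  · simp only [hμw, integral_const_mul, hwTT]
    have h1 : μ ^ p = μ * μ ^ (p - 1) := by
      nth_rewrite 2 [← Real.rpow_one μ]
      rw [← Real.rpow_add hμ]; congr 1; ring
    have h2 : (1 / p) * (μ ^ p * (L⁻¹ * P)) ≤
        (1 / p) * (μ ^ p * ∫ x, (‖w x‖ ^ 2) ^ p) := by gcongr
    rw [h1] at h2 ⊢
    linarith

lemma wt_nonneg {N : ℕ} {lam : ℝ} (h : (N : ℝ) - 1 ≤ lam) (n : Fin N) : 0 ≤ wt N lam n := by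
  unfold wt; split_ifs <;> linarith

lemma wt_le_one {N : ℕ} {lam : ℝ} (h : lam ≤ N) (n : Fin N) : wt N lam n ≤ 1 := by
  unfold wt; split_ifs <;> linarith

lemma wt_succ {k : ℕ} (lam : ℝ) (n : Fin (k + 1)) :
    wt (k + 1) lam n = if (n : ℕ) = k then lam - k else 1 := by
  unfold wt
  by_cases h : (n : ℕ) = k
  · simp only [h, Nat.add_sub_cancel, if_true]; push_cast; ring
  · simp [h]

lemma natCeil_eq_add_one {k : ℕ} {lam : ℝ} (h1 : k < lam) (h2 : lam ≤ k + 1) :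
    ⌈lam⌉₊ = k + 1 := by
  rw [Nat.ceil_eq_iff (by omega)]
  push_cast
  exact ⟨by simpa using h1, h2⟩

lemma exists_admissible {d : ℕ} (hd : 1 ≤ d) (N : ℕ) :
    ∃ u : Fin N → Ed d → ℂ, Admissible d N u := by
  induction N with
  | zero => exact ⟨fun n => n.elim0, ⟨fun n => n.elim0, fun n => n.elim0, fun n => n.elim0,
      fun n => n.elim0⟩⟩
  | succ N ih =>
    obtain ⟨u, hu⟩ := ih
    have hd0 : (0 : ℝ) < d := by positivity
    obtain ⟨δ, -, h⟩ := exists_extension_energy_le hd (p := 1 + 1 / d)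
      (by linarith [one_div_pos.2 hd0]) (by gcongr; norm_num) N one_pos
    obtain ⟨w, hw, -⟩ := h u hu
    exact ⟨_, hw⟩

section Jw

variable {d : ℕ} {p : ℝ}

lemma Jw_le_energyW (hd : 1 ≤ d) (hp1 : 1 < p) (hp2 : p < 1 + 2 / d) {lam : ℝ} (hlam : 0 ≤ lam)
    {u : Fin ⌈lam⌉₊ → Ed d → ℂ} (hu : Admissible d ⌈lam⌉₊ u) :
    Jw d p lam ≤ energyW d ⌈lam⌉₊ p lam u := by
  obtain ⟨B, hB⟩ := exists_le_occEnergy hd hp1 hp2 ⌈lam⌉₊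
  refine csInf_le ⟨B, ?_⟩ ⟨u, hu, rfl⟩
  rintro _ ⟨v, hv, rfl⟩
  exact hB v hv _ (wt_nonneg (by linarith [Nat.ceil_lt_add_one hlam])) (wt_le_one (Nat.le_ceil _))

lemma le_Jw (hd : 1 ≤ d) {lam b : ℝ}
    (h : ∀ u, Admissible d ⌈lam⌉₊ u → b ≤ energyW d ⌈lam⌉₊ p lam u) : b ≤ Jw d p lam := by
  obtain ⟨u, hu⟩ := exists_admissible hd ⌈lam⌉₊
  refine le_csInf ⟨_, u, hu, rfl⟩ ?_
  rintro _ ⟨v, hv, rfl⟩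
  exact h v hv

lemma Jw_le_occEnergy (hd : 1 ≤ d) (hp1 : 1 < p) (hp2 : p < 1 + 2 / d) {lam : ℝ}
    (hlam : 0 ≤ lam) {M N : ℕ} (hN : ⌈lam⌉₊ = N) {v : Fin M → Ed d → ℂ}
    (hv : Admissible d M v) {a : Fin M → ℝ} {f : Fin N → Fin M} (hf : Function.Injective f)
    (haf : ∀ n, a (f n) = wt N lam n) (ha : ∀ m, m ∉ Set.range f → a m = 0) :
    Jw d p lam ≤ occEnergy p a v := by
  subst hN
  rw [← occEnergy_comp_injective hf ha, show a ∘ f = wt ⌈lam⌉₊ lam from funext haf]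
  exact Jw_le_energyW hd hp1 hp2 hlam (hv.comp_injective hf)

lemma Jw_le_occEnergy_wt (hd : 1 ≤ d) (hp1 : 1 < p) (hp2 : p < 1 + 2 / d) {lam : ℝ} {k : ℕ}
    (h1 : k ≤ lam) (h2 : lam ≤ k + 1) {u : Fin (k + 1) → Ed d → ℂ}
    (hu : Admissible d (k + 1) u) : Jw d p lam ≤ occEnergy p (wt (k + 1) lam) u := by
  have hlam : 0 ≤ lam := (Nat.cast_nonneg k).trans h1
  rcases h1.eq_or_lt with rfl | h1
  · refine Jw_le_occEnergy hd hp1 hp2 hlam (Nat.ceil_natCast k) hu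
      (Fin.castSucc_injective k) (fun n => ?_) fun m hm => ?_
    · have := n.isLt
      rw [wt_succ, wt, if_neg (by simp; omega)]
      split_ifs <;> ring
    · have : m = Fin.last k := by
        by_contra h
        exact hm ⟨m.castPred h, by simp⟩
      simp [wt_succ, this]
  · exact Jw_le_occEnergy hd hp1 hp2 hlam (natCeil_eq_add_one h1 h2) hu
      Function.injective_id (fun n => rfl) (by simp)

lemma occEnergy_snoc_le (hd : 1 ≤ d) (hp1 : 1 < p) (hp2 : p < 1 + 2 / d) {M : ℕ}
    {u : Fin M → Ed d → ℂ} (hu : Admissible d M u) {a : Fin M → ℝ} (ha : ∀ n, 0 ≤ a n)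
    {μ : ℝ} (hμ : 0 ≤ μ) {w : Ed d → ℂ}
    (hw : Admissible d (M + 1) (Fin.snoc (α := fun _ => Ed d → ℂ) u w))
    (hwi : Integrable (fun x => (μ * ‖w x‖ ^ 2) ^ p)) :
    occEnergy p (Fin.snoc (α := fun _ => ℝ) a μ) (Fin.snoc (α := fun _ => Ed d → ℂ) u w) ≤
      occEnergy p a u +
        (μ * (∫ x, ‖fderiv ℝ w x‖ ^ 2) - (1 / p) * ∫ x, (μ * ‖w x‖ ^ 2) ^ p) := by
  have hsn : ∀ n, 0 ≤ (Fin.snoc (α := fun _ => ℝ) a μ : Fin (M + 1) → ℝ) n := fun n => by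
    refine Fin.lastCases ?_ (fun i => ?_) n
    · simpa using hμ
    · simpa using ha i
  have hi := hw.integrable_occDensity_rpow hd hp1 hp2 hsn
  have hiu := hu.integrable_occDensity_rpow hd hp1 hp2 ha
  simp only [Fin.sum_univ_castSucc, Fin.snoc_castSucc, Fin.snoc_last] at hi
  have h1 : (∫ x, (∑ n, a n * ‖u n x‖ ^ 2) ^ p) + ∫ x, (μ * ‖w x‖ ^ 2) ^ p ≤
      ∫ x, (∑ n, a n * ‖u n x‖ ^ 2 + μ * ‖w x‖ ^ 2) ^ p := by
    rw [← integral_add hiu hwi]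
    refine integral_mono (hiu.add hwi) hi fun x => ?_
    exact Real.add_rpow_le_rpow_add
      (Finset.sum_nonneg fun n _ => mul_nonneg (ha n) (by positivity)) (by positivity) hp1.le
  have hp0 : 0 ≤ 1 / p := by positivity
  simp only [occEnergy, Fin.sum_univ_castSucc, Fin.snoc_castSucc, Fin.snoc_last]
  linarith [mul_le_mul_of_nonneg_left h1 hp0]

/-- By concavity in the occupation numbers, two fractional occupations can be merged into one. -/
lemma Jw_add_le_occEnergy_snoc (hd : 1 ≤ d) (hp1 : 1 < p) (hp2 : p < 1 + 2 / d) {lam μ : ℝ}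
    (hlam : 0 ≤ lam) (hμ0 : 0 < μ) (hμ1 : μ ≤ 1) {v : Fin (⌈lam⌉₊ + 1) → Ed d → ℂ}
    (hv : Admissible d (⌈lam⌉₊ + 1) v) :
    Jw d p (lam + μ) ≤ occEnergy p (Fin.snoc (α := fun _ => ℝ) (wt ⌈lam⌉₊ lam) μ) v := by
  rcases hlam.eq_or_lt with rfl | hlam0
  · have h := Jw_le_occEnergy_wt hd hp1 hp2 (lam := 0 + μ) (k := ⌈(0 : ℝ)⌉₊)
      (by simpa using hμ0.le) (by simpa using hμ1) hv
    convert h using 2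
    funext n
    have hn : n = Fin.last _ := Fin.ext (by have := n.isLt; simp at this ⊢; omega)
    rw [hn, wt_succ]
    simp
  obtain ⟨k, hk⟩ : ∃ k, ⌈lam⌉₊ = k + 1 := Nat.exists_eq_add_one.2 (Nat.ceil_pos.2 hlam0)
  have hk1 : k < lam := by
    have := Nat.ceil_lt_add_one hlam
    rw [hk] at this; push_cast at this; linarith
  have hk2 : lam ≤ k + 1 := by
    have := Nat.le_ceil lam
    rw [hk] at this; exact_mod_cast this
  revert v
  rw [hk]
  intro v hv
  set S : ℝ := lam - k + μ with hS
  let g : ℝ → Fin (k + 1 + 1) → ℝ := fun x n =>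
    if (n : ℕ) = k then x else if (n : ℕ) = k + 1 then S - x else 1
  have hg : Fin.snoc (α := fun _ => ℝ) (wt (k + 1) lam) μ = g (lam - k) := by
    funext n
    refine Fin.lastCases ?_ (fun i => ?_) n
    · simp [g, hS]
    · have := i.isLt
      simp only [g, Fin.snoc_castSucc, Fin.val_castSucc, wt_succ]
      rw [if_neg (c := (i : ℕ) = k + 1) (by omega)]
  have hg0 : ∀ x, 0 ≤ x → x ≤ S → ∀ n, 0 ≤ g x n := fun x h0 h1 n => by
    simp only [g]; split_ifs <;> linarith
  have hseg : ∀ lo hi : ℝ, 0 ≤ lo → lo ≤ lam - k → lam - k ≤ hi → hi ≤ S →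
      Jw d p (lam + μ) ≤ occEnergy p (g lo) v → Jw d p (lam + μ) ≤ occEnergy p (g hi) v →
      Jw d p (lam + μ) ≤ occEnergy p (g (lam - k)) v := by
    intro lo hi h0 h1 h2 h3 e1 e2
    have hm : lam - k ∈ segment ℝ lo hi := by
      rw [segment_eq_Icc (h1.trans h2)]; exact ⟨h1, h2⟩
    obtain ⟨a, b, ha, hb, hab, he⟩ := hm
    refine (le_min e1 e2).trans ((hv.concaveOn_occEnergy hd hp1 hp2).ge_on_segment
      (hg0 lo h0 (h1.trans (h2.trans h3))) (hg0 hi (h0.trans (h1.trans h2)) h3)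
      ⟨a, b, ha, hb, hab, ?_⟩)
    funext n
    simp only [g, Pi.add_apply, Pi.smul_apply, smul_eq_mul] at he ⊢
    split_ifs
    · exact he
    · rw [← he]
      linear_combination (S : ℝ) * hab
    · linarith
  have hlamμ : 0 ≤ lam + μ := by linarith
  rw [hg]
  rcases le_or_gt S 1 with hS1 | hS1
  · have hceil : ⌈lam + μ⌉₊ = k + 1 := natCeil_eq_add_one (by linarith) (by linarith)
    refine hseg 0 S le_rfl (by linarith) (by linarith) le_rfl ?_ ?_
    · refine Jw_le_occEnergy hd hp1 hp2 hlamμ hceil hv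
        (f := Fin.succAbove ⟨k, by omega⟩) Fin.succAbove_right_injective (fun n => ?_)
        fun m hm => ?_
      · have := n.isLt
        rw [wt_succ]
        rcases lt_or_ge (n : ℕ) k with h | h
        · rw [Fin.succAbove_of_castSucc_lt _ _ (by simpa [Fin.lt_def] using h)]
          simp only [g, Fin.val_castSucc]
          rw [if_neg (by omega), if_neg (by omega), if_neg (by omega)]
        · rw [Fin.succAbove_of_le_castSucc _ _ (by simpa [Fin.le_def] using h)]
          simp only [g, Fin.val_succ]
          rw [if_neg (by omega), if_pos (by omega), if_pos (by omega)]
          linarith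
      · have : m = ⟨k, by omega⟩ := by
          by_contra h
          exact hm (Fin.exists_succAbove_eq h)
        simp [g, this]
    · refine Jw_le_occEnergy hd hp1 hp2 hlamμ hceil hv (Fin.castSucc_injective _)
        (fun n => ?_) fun m hm => ?_
      · have := n.isLt
        simp only [g, Fin.val_castSucc, wt_succ]
        rw [if_neg (c := (n : ℕ) = k + 1) (by omega)]
        split_ifs <;> linarith
      · have : m = Fin.last _ := by
          by_contra h
          exact hm ⟨m.castPred h, by simp⟩
        simp [g, this]
  · have hceil : ⌈lam + μ⌉₊ = k + 1 + 1 :=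
      natCeil_eq_add_one (by push_cast; linarith) (by push_cast; linarith)
    refine hseg (S - 1) 1 (by linarith) (by linarith) (by linarith) hS1.le ?_ ?_
    · refine Jw_le_occEnergy hd hp1 hp2 hlamμ hceil hv
        (f := Equiv.swap ⟨k, by omega⟩ ⟨k + 1, by omega⟩) (Equiv.injective _) (fun n => ?_)
        fun m hm => absurd (Equiv.surjective _ m) hm
      rw [wt_succ]
      by_cases h1 : (n : ℕ) = k
      · rw [show n = ⟨k, by omega⟩ from Fin.ext h1, Equiv.swap_apply_left]
        simp [g]
      by_cases h2 : (n : ℕ) = k + 1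
      · rw [show n = ⟨k + 1, by omega⟩ from Fin.ext h2, Equiv.swap_apply_right]
        simp [g]
        linarith
      · rw [Equiv.swap_apply_of_ne_of_ne (fun h => h1 (by simp [h])) (fun h => h2 (by simp [h]))]
        simp [g, h1, h2]
    · refine Jw_le_occEnergy hd hp1 hp2 hlamμ hceil hv Function.injective_id (fun n => ?_)
        (by simp)
      simp only [g, id, wt_succ]
      split_ifs
      · omega
      · rfl
      · push_cast; linarith
      · rfl

lemma Jw_add_lt (hd : 1 ≤ d) (hp1 : 1 < p) (hp2 : p < 1 + 2 / d) {lam μ : ℝ}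
    (hlam : 0 ≤ lam) (hμ0 : 0 < μ) (hμ1 : μ ≤ 1) : Jw d p (lam + μ) < Jw d p lam := by
  obtain ⟨δ, hδ, h⟩ := exists_extension_energy_le hd hp1 hp2 ⌈lam⌉₊ hμ0
  have : Jw d p (lam + μ) + δ ≤ Jw d p lam := by
    refine le_Jw hd fun u hu => ?_
    obtain ⟨w, hw, hwi, hwe⟩ := h u hu
    have h1 := Jw_add_le_occEnergy_snoc hd hp1 hp2 hlam hμ0 hμ1 hw
    have h2 := occEnergy_snoc_le hd hp1 hp2 hu (a := wt ⌈lam⌉₊ lam)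
      (wt_nonneg (by linarith [Nat.ceil_lt_add_one hlam])) hμ0.le hw hwi
    rw [energyW_eq_occEnergy]
    linarith
  linarith

lemma Jw_strictAntiOn (hd : 1 ≤ d) (hp1 : 1 < p) (hp2 : p < 1 + 2 / d) :
    StrictAntiOn (Jw d p) (Set.Ici 0) := by
  have key : ∀ n : ℕ, ∀ lam' lam : ℝ, 0 ≤ lam' → lam' < lam → lam ≤ lam' + n →
      Jw d p lam < Jw d p lam' := by
    intro n
    induction n with
    | zero => intro lam' lam _ h1 h2; simp at h2; linarith
    | succ n ih =>
      intro lam' lam h0 h1 h2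
      push_cast at h2
      rcases le_or_gt lam (lam' + 1) with h | h
      · simpa using Jw_add_lt hd hp1 hp2 h0 (μ := lam - lam') (by linarith) (by linarith)
      · refine lt_trans ?_ (ih lam' (lam - 1) h0 (by linarith) (by linarith))
        simpa using Jw_add_lt hd hp1 hp2 (lam := lam - 1) (by linarith) one_pos le_rfl
  intro lam' h0 lam _ h1
  obtain ⟨n, hn⟩ := exists_nat_ge (lam - lam')
  exact key n lam' lam h0 h1 (by linarith)

lemma Jw_continuousWithinAt_Ici (hd : 1 ≤ d) (hp1 : 1 < p) (hp2 : p < 1 + 2 / d) {lam₀ : ℝ}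
    (h0 : 0 ≤ lam₀) : ContinuousWithinAt (Jw d p) (Set.Ici lam₀) lam₀ := by
  set k := ⌊lam₀⌋₊ with hk
  have hk1 : k ≤ lam₀ := Nat.floor_le h0
  have hk2 : lam₀ < k + 1 := Nat.lt_floor_add_one lam₀
  let θ : ℝ → ℝ := fun lam => (lam - lam₀) / (k + 1 - lam₀)
  let lower : ℝ → ℝ := fun lam => (1 - θ lam) * Jw d p lam₀ + θ lam * Jw d p (k + 1)
  have hlc : Tendsto lower (𝓝[>] lam₀) (𝓝 (Jw d p lam₀)) := by
    have hc : Continuous lower := by fun_prop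
    have := hc.tendsto lam₀
    simp only [lower, θ, sub_self, zero_div, sub_zero, one_mul, zero_mul, add_zero] at this
    exact this.mono_left nhdsWithin_le_nhds
  rw [← continuousWithinAt_Ioi_iff_Ici]
  refine tendsto_of_tendsto_of_tendsto_of_le_of_le' hlc tendsto_const_nhds ?_ ?_
  · filter_upwards [Ioc_mem_nhdsGT hk2] with lam hlam
    have hden : 0 < (k : ℝ) + 1 - lam₀ := by linarith
    have hθ0 : 0 ≤ θ lam := div_nonneg (by linarith [hlam.1]) hden.le
    have hθ1 : θ lam ≤ 1 := (div_le_one hden).2 (by linarith [hlam.2])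
    have hceil : ⌈lam⌉₊ = k + 1 := natCeil_eq_add_one (hk1.trans_lt hlam.1) hlam.2
    refine le_Jw hd ?_
    rw [hceil]
    intro u hu
    rw [energyW_eq_occEnergy]
    have hw : wt (k + 1) lam =
        (1 - θ lam) • wt (k + 1) lam₀ + θ lam • wt (k + 1) ((k : ℝ) + 1) := by
      funext n
      simp only [Pi.add_apply, Pi.smul_apply, smul_eq_mul, wt_succ]
      split_ifs
      · simp only [θ]; field_simp; ring
      · ring
    have hconc := (hu.concaveOn_occEnergy hd hp1 hp2).2
      (x := wt (k + 1) lam₀) (wt_nonneg (by push_cast; linarith))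
      (y := wt (k + 1) ((k : ℝ) + 1)) (wt_nonneg (by push_cast; linarith))
      (sub_nonneg.2 hθ1) hθ0 (by ring)
    rw [← hw] at hconc
    refine le_trans ?_ hconc
    simp only [smul_eq_mul, lower]
    have e1 := Jw_le_occEnergy_wt hd hp1 hp2 hk1 hk2.le hu
    have e2 := Jw_le_occEnergy_wt hd hp1 hp2 (lam := (k : ℝ) + 1) (by linarith) le_rfl hu
    exact add_le_add (mul_le_mul_of_nonneg_left e1 (sub_nonneg.2 hθ1))
      (mul_le_mul_of_nonneg_left e2 hθ0)
  · filter_upwards [self_mem_nhdsWithin] with lam hlam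
    exact (Jw_strictAntiOn hd hp1 hp2).antitoneOn h0 (h0.trans (le_of_lt hlam)) (le_of_lt hlam)

lemma Jw_tendsto_nhdsLT (hd : 1 ≤ d) (hp1 : 1 < p) (hp2 : p < 1 + 2 / d) {lam₀ : ℝ}
    (h0 : 0 < lam₀) : Tendsto (Jw d p) (𝓝[<] lam₀) (𝓝 (Jw d p lam₀)) := by
  obtain ⟨k, hk⟩ : ∃ k, ⌈lam₀⌉₊ = k + 1 := Nat.exists_eq_add_one.2 (Nat.ceil_pos.2 h0)
  have hk1 : k < lam₀ := by
    have := Nat.ceil_lt_add_one h0.le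
    rw [hk] at this; push_cast at this; linarith
  have hk2 : lam₀ ≤ k + 1 := by
    have := Nat.le_ceil lam₀
    rw [hk] at this; exact_mod_cast this
  have hk0 : (0 : ℝ) ≤ k := Nat.cast_nonneg k
  refine tendsto_order.2 ⟨fun a ha => ?_, fun b hb => ?_⟩
  · filter_upwards [Ioo_mem_nhdsLT h0] with lam hlam
    exact ha.trans (Jw_strictAntiOn hd hp1 hp2 hlam.1.le h0.le hlam.2)
  · obtain ⟨u, hu, hub⟩ : ∃ u : Fin (k + 1) → Ed d → ℂ, Admissible d (k + 1) u ∧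
        occEnergy p (wt (k + 1) lam₀) u < b := by
      by_contra! h
      refine hb.not_ge (le_Jw hd ?_)
      rw [hk]
      exact h
    set R := ∫ x, (∑ n, wt (k + 1) lam₀ n * ‖u n x‖ ^ 2) ^ p with hR
    let q : ℝ → ℝ := fun lam => (lam - k) / (lam₀ - k)
    have hden : 0 < lam₀ - k := by linarith
    let upper : ℝ → ℝ := fun lam =>
      (∑ n, wt (k + 1) lam₀ n * ∫ x : Ed d, ‖fderiv ℝ (u n) x‖ ^ 2) - (1 / p) * (q lam ^ p * R)
    have hupper : Tendsto upper (𝓝[<] lam₀) (𝓝 (occEnergy p (wt (k + 1) lam₀) u)) := by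
      have hq : Continuous fun lam => q lam ^ p :=
        Continuous.rpow_const (by fun_prop) fun _ => Or.inr (by linarith)
      have hc : Continuous upper := by fun_prop
      have := hc.tendsto lam₀
      have hq1 : q lam₀ = 1 := div_self hden.ne'
      simp only [upper, hq1, Real.one_rpow, one_mul] at this
      exact this.mono_left nhdsWithin_le_nhds
    filter_upwards [hupper.eventually (eventually_lt_nhds hub), Ioo_mem_nhdsLT hk1]
      with lam hlt hlam
    refine lt_of_le_of_lt ?_ hlt
    have hq0 : 0 ≤ q lam := div_nonneg (by linarith [hlam.1]) hden.le
    have hq1 : q lam ≤ 1 := (div_le_one hden).2 (by linarith [hlam.2])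
    have hw0 := wt_nonneg (N := k + 1) (lam := lam) (by push_cast; linarith [hlam.1])
    have hw0' := wt_nonneg (N := k + 1) (lam := lam₀) (by push_cast; linarith)
    have hwle : ∀ n, wt (k + 1) lam n ≤ wt (k + 1) lam₀ n := fun n => by
      simp only [wt_succ]; split_ifs <;> linarith [hlam.2]
    have hwge : ∀ n, q lam * wt (k + 1) lam₀ n ≤ wt (k + 1) lam n := fun n => by
      simp only [wt_succ]
      split_ifs
      · simp only [q]; rw [div_mul_cancel₀ _ hden.ne']
      · simpa using hq1
    refine (Jw_le_occEnergy_wt hd hp1 hp2 hlam.1.le (hlam.2.le.trans hk2) hu).trans ?_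
    simp only [occEnergy, upper]
    have hp0 : 0 ≤ 1 / p := by positivity
    refine sub_le_sub (Finset.sum_le_sum fun n _ => mul_le_mul_of_nonneg_right (hwle n)
      (integral_nonneg fun x => by positivity)) (mul_le_mul_of_nonneg_left ?_ hp0)
    rw [hR, ← integral_const_mul]
    refine integral_mono ((hu.integrable_occDensity_rpow hd hp1 hp2 hw0').const_mul _)
      (hu.integrable_occDensity_rpow hd hp1 hp2 hw0) fun x => ?_
    have hρ : 0 ≤ ∑ n, wt (k + 1) lam₀ n * ‖u n x‖ ^ 2 :=
      Finset.sum_nonneg fun n _ => mul_nonneg (hw0' n) (by positivity)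
    simp only
    rw [← Real.mul_rpow hq0 hρ, Finset.mul_sum]
    refine Real.rpow_le_rpow (Finset.sum_nonneg fun n _ => mul_nonneg hq0
      (mul_nonneg (hw0' n) (by positivity))) (Finset.sum_le_sum fun n _ => ?_) (by linarith)
    rw [← mul_assoc]
    exact mul_le_mul_of_nonneg_right (hwge n) (by positivity)

end Jw

/-- `λ ↦ J(λ)` is strictly decreasing on `(0,∞)` and continuous
on `[0,∞)`. -/
theorem statement9 (d : ℕ) (hd : 1 ≤ d) (p : ℝ) (hp1 : 1 < p)
    (hp2 : p < 1 + 2 / d) :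
    (∀ lam' lam : ℝ, 0 < lam' → lam' < lam → Jw d p lam < Jw d p lam') ∧
    ContinuousOn (Jw d p) (Set.Ici 0) := by
  refine ⟨fun lam' lam h0 h => Jw_strictAntiOn hd hp1 hp2 h0.le (h0.trans h).le h,
    fun lam₀ h0 => ?_⟩
  rcases (show (0 : ℝ) ≤ lam₀ from h0).eq_or_lt with rfl | h
  · exact Jw_continuousWithinAt_Ici hd hp1 hp2 le_rfl
  · refine (continuousAt_iff_continuous_left'_right'.2 ⟨Jw_tendsto_nhdsLT hd hp1 hp2 h, ?_⟩
      ).continuousWithinAt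
    exact (Jw_continuousWithinAt_Ici hd hp1 hp2 h.le).mono Set.Ioi_subset_Ici_self
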